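/- arXiv:2305.08795 — 10 statements merged into one kernel-verified Lean document; each statement's English description precedes it below -/
import Mathlib

section
/- Let V₁ and V₂ be representations of G. For every α ∈ Hom_U(V₁, Ind_U^G(V₂)) and every x ∈ V₁, the function g ↦ g⁻¹·(α(g⁻¹·x)(g⁻¹)) belongs to Ind_U^G(V₂) (i.e. it satisfies the transformation rule f(gu) = u⁻¹·f(g)), and the resulting map 𝒥(α) : V₁ → Ind_U^G(V₂) defined by 𝒥(α)(x)(g) = g⁻¹·(α(g⁻¹·x)(g⁻¹)) is U-equivariant, so that 𝒥(α) ∈ Hom_U(V₁, Ind_U^G(V₂)). -/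
/-- The transformation rule of functions in `Ind_U^G(V)`:
`f (g * u) = u⁻¹ • f g` for all `g ∈ G` and `u ∈ U`. -/
def IsInd {G V : Type*} [Group G] (U : Subgroup G) [SMul G V] (f : G → V) : Prop :=
  ∀ g : G, ∀ u ∈ U, f (g * u) = u⁻¹ • f g

/-- `α : V₁ → (G → V₂)` is a `U`-equivariant `k`-linear map `V₁ → Ind_U^G(V₂)`:
it is `k`-linear, takes values in `Ind_U^G(V₂)`, and is `U`-equivariant for the
`G`-action `(g • f) x = f (g⁻¹ * x)` on the induced representation. -/
def IsIndHom (k : Type*) {G V₁ V₂ : Type*} [Semiring k] [Group G] (U : Subgroup G)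
    [AddCommMonoid V₁] [Module k V₁] [SMul G V₁]
    [AddCommMonoid V₂] [Module k V₂] [SMul G V₂] (α : V₁ → G → V₂) : Prop :=
  (∀ (c : k) (x y : V₁), α (c • x + y) = c • α x + α y) ∧
  (∀ x : V₁, IsInd U (α x)) ∧
  (∀ u ∈ U, ∀ (x : V₁) (g : G), α (u • x) g = α x (u⁻¹ * g))

/-- The map `𝒥`, `𝒥(α) x g = g⁻¹ • (α (g⁻¹ • x) g⁻¹)`. -/
def Jmap {G V₁ V₂ : Type*} [Group G] [SMul G V₁] [SMul G V₂]
    (α : V₁ → G → V₂) : V₁ → G → V₂ :=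
  fun x g => g⁻¹ • α (g⁻¹ • x) g⁻¹

/-- For `α ∈ Hom_U(V₁, Ind_U^G(V₂))`, each `𝒥(α) x` again lies in `Ind_U^G(V₂)`, and
`𝒥(α)` is a `U`-equivariant `k`-linear map, i.e. `𝒥(α) ∈ Hom_U(V₁, Ind_U^G(V₂))`. -/
theorem stmt0 {k G V₁ V₂ : Type*} [Field k] [Group G] (U : Subgroup G)
    [AddCommGroup V₁] [Module k V₁] [DistribMulAction G V₁] [SMulCommClass G k V₁]
    [AddCommGroup V₂] [Module k V₂] [DistribMulAction G V₂] [SMulCommClass G k V₂]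
    (α : V₁ → G → V₂) (hα : IsIndHom k U α) :
    IsIndHom k U (Jmap α) := by
  obtain ⟨h1, h2, h3⟩ := hα
  refine ⟨?_, ?_, ?_⟩
  · intro c x y
    funext g
    simp only [Jmap, Pi.add_apply, Pi.smul_apply]
    rw [smul_add, smul_comm g⁻¹ c x, h1, Pi.add_apply, Pi.smul_apply, smul_add,
      smul_comm g⁻¹ c]
  · intro x g u hu
    simp only [Jmap]
    rw [mul_inv_rev, mul_smul u⁻¹ g⁻¹ x, h3 u⁻¹ (U.inv_mem hu), inv_inv,
      mul_inv_cancel_left, mul_smul]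
  · intro u hu x g
    simp only [Jmap]
    rw [mul_inv_rev, inv_inv, h2 _ g⁻¹ u hu, mul_smul, mul_smul, smul_inv_smul]
end

section
/- Let V₁ and V₂ be representations of G. Suppose that every double coset UhU (h ∈ G) is a finite union of left cosets of U, and that V₁ is finitely generated as a U-representation. Then 𝒥 maps the subspace Hom_U(V₁, ind_U^G(V₂)) of Hom_U(V₁, Ind_U^G(V₂)) into itself, and hence restricts to an involutive k-linear automorphism of Hom_U(V₁, ind_U^G(V₂)). -/
/-- `f : G → V` is supported in finitely many left cosets of `U`. -/
def FinSupp {G V : Type*} [Group G] (U : Subgroup G) [Zero V] (f : G → V) : Prop :=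
  ∃ S : Finset G, ∀ g : G, f g ≠ 0 → ∃ s ∈ S, s⁻¹ * g ∈ U

/-- The double coset `UhU`. -/
def DCoset {G : Type*} [Group G] (U : Subgroup G) (h : G) : Set G :=
  {g | ∃ u₁ ∈ U, ∃ u₂ ∈ U, g = u₁ * h * u₂}

/-- Suppose every double coset `UhU` is a finite union of left cosets of `U`, and `V₁` is
finitely generated as a `U`-representation.  Then `𝒥` maps the subspace
`Hom_U(V₁, ind_U^G(V₂))` of `Hom_U(V₁, Ind_U^G(V₂))` into itself, and hence restricts to
an involutive `k`-linear automorphism of `Hom_U(V₁, ind_U^G(V₂))`. -/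
theorem stmt2 {k G V₁ V₂ : Type*} [Field k] [Group G] (U : Subgroup G)
    [AddCommGroup V₁] [Module k V₁] [DistribMulAction G V₁] [SMulCommClass G k V₁]
    [AddCommGroup V₂] [Module k V₂] [DistribMulAction G V₂] [SMulCommClass G k V₂]
    (hDC : ∀ h : G, ∃ S : Finset G, ∀ g ∈ DCoset U h, ∃ s ∈ S, s⁻¹ * g ∈ U)
    (hFG : ∃ T : Finset V₁,
      Submodule.span k {x : V₁ | ∃ t ∈ T, ∃ u ∈ U, x = u • t} = ⊤) :
    -- `𝒥` preserves the subspace `Hom_U(V₁, ind_U^G(V₂))`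
    (∀ α : V₁ → G → V₂, IsIndHom k U α → (∀ x, FinSupp U (α x)) →
        IsIndHom k U (Jmap α) ∧ (∀ x, FinSupp U (Jmap α x))) ∧
    -- it is involutive there
    (∀ α : V₁ → G → V₂, IsIndHom k U α → (∀ x, FinSupp U (α x)) →
        Jmap (Jmap α) = α) ∧
    -- and `k`-linear there
    (∀ (c : k) (α β : V₁ → G → V₂),
        IsIndHom k U α → (∀ x, FinSupp U (α x)) →
        IsIndHom k U β → (∀ x, FinSupp U (β x)) →
        Jmap (c • α + β) = c • Jmap α + Jmap β) := by
  classical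
  refine ⟨?_, ?_, ?_⟩
  · rintro α ⟨hlin, hind, heq⟩ hfs
    refine ⟨⟨?_, ?_, ?_⟩, ?_⟩
    · intro c x y
      funext g
      simp only [Jmap, smul_add, Pi.add_apply, Pi.smul_apply]
      rw [smul_comm g⁻¹ c x, hlin]
      simp only [smul_add, Pi.add_apply, Pi.smul_apply]
      rw [smul_comm g⁻¹ c]
    · intro x g u hu
      simp only [Jmap, mul_inv_rev, mul_smul]
      rw [heq u⁻¹ (U.inv_mem hu)]
      simp
    · intro u hu x g
      simp only [Jmap, mul_inv_rev, inv_inv, mul_smul]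
      rw [hind _ _ u hu]
      simp
    · obtain ⟨T, hT⟩ := hFG
      choose S hS using hfs
      choose D hD using hDC
      have key : ∀ x g, α x g ≠ 0 → ∃ h ∈ T.biUnion S, g ∈ DCoset U h := by
        intro x
        have hx : x ∈ Submodule.span k {x : V₁ | ∃ t ∈ T, ∃ u ∈ U, x = u • t} := by
          rw [hT]; trivial
        have h0 : α 0 = 0 := by
          have := hlin 1 0 0
          simpa using this
        induction hx using Submodule.span_induction with
        | mem x hx =>
          obtain ⟨t, ht, u, hu, rfl⟩ := hx
          intro g hg
          rw [heq u hu] at hg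
          obtain ⟨s, hs, hsu⟩ := hS t _ hg
          exact ⟨s, Finset.mem_biUnion.2 ⟨t, ht, hs⟩, u, hu, _, hsu, by group⟩
        | zero => intro g hg; simp [h0] at hg
        | add x y _ _ ihx ihy =>
          intro g hg
          by_cases h : α x g = 0
          · refine ihy g fun h' => hg ?_
            have := congrFun (hlin 1 x y) g
            simpa [h, h'] using this
          · exact ihx g h
        | smul c x _ ih =>
          intro g hg
          refine ih g fun h' => hg ?_
          have := congrFun (hlin c x 0) g
          simpa [h', h0] using this
      intro x
      refine ⟨(T.biUnion S).biUnion fun h => D h⁻¹, fun g hg => ?_⟩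
      have hg' : α (g⁻¹ • x) g⁻¹ ≠ 0 := fun h => hg (by simp [Jmap, h])
      obtain ⟨h, hh, u₁, hu₁, u₂, hu₂, e⟩ := key _ _ hg'
      obtain ⟨s, hs, hsu⟩ := hD h⁻¹ g
        ⟨u₂⁻¹, U.inv_mem hu₂, u₁⁻¹, U.inv_mem hu₁, by
          rw [← inv_inv g, e]; group⟩
      exact ⟨s, Finset.mem_biUnion.2 ⟨h, hh, hs⟩, hsu⟩
  · intro α _ _
    funext x g
    simp [Jmap]
  · intro c α β _ _ _ _
    funext x g
    simp only [Jmap, smul_add, Pi.add_apply, Pi.smul_apply]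
    rw [smul_comm g⁻¹ c]
end

section
/- Let V₁ and V₂ be representations of G. The map rec : Hom_U(V₂, Ind_U^G(V₁)) → Hom_U(ind_U^G(V₂), V₁) given by rec(α)(φ) = Σ_{g ∈ G/U} α(φ(g))(g⁻¹) is well defined (for each φ ∈ ind_U^G(V₂) the summand α(φ(g))(g⁻¹) depends only on the left coset gU, vanishes for all but finitely many cosets, and rec(α) is U-equivariant and k-linear), and rec is a k-linear bijection whose inverse is given by rec⁻¹(β)(v)(g) = β(char_{g⁻¹,U}^v) for v ∈ V₂ and g ∈ G. -/
/-- `f` lies in the compact induction `ind_U^G(V)`. -/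
def IsCInd {G V : Type*} [Group G] (U : Subgroup G) [Zero V] [SMul G V] (f : G → V) : Prop :=
  IsInd U f ∧ FinSupp U f

open Classical in
/-- `char_{h,U}^v ∈ ind_U^G(V)`: the function supported on `hU` with
`char_{h,U}^v (h * u) = u⁻¹ • v`. -/
noncomputable def charFn {G V : Type*} [Group G] (U : Subgroup G) [Zero V] [SMul G V]
    (h : G) (v : V) : G → V :=
  fun g => if g⁻¹ * h ∈ U then (g⁻¹ * h) • v else 0

/-- `rec(α)(φ) = Σ_{g ∈ G/U} α (φ g) g⁻¹`, the sum running over representatives of the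
left cosets of `U` in `G`. -/
noncomputable def recMap {G V₁ V₂ : Type*} [Group G] (U : Subgroup G) [AddCommMonoid V₁]
    (α : V₂ → G → V₁) (φ : G → V₂) : V₁ :=
  ∑ᶠ q : G ⧸ U, α (φ q.out) q.out⁻¹

section Aux
set_option linter.unusedSectionVars false
variable {k G V₁ V₂ : Type*} [Field k] [Group G] (U : Subgroup G)
    [AddCommGroup V₁] [Module k V₁] [DistribMulAction G V₁] [SMulCommClass G k V₁]
    [AddCommGroup V₂] [Module k V₂] [DistribMulAction G V₂] [SMulCommClass G k V₂]

theorem aux_zero {α : V₂ → G → V₁} (h : IsIndHom k U α) : α 0 = 0 := by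
  have := h.1 (-1) 0 0
  simpa using this

theorem aux_coset {α : V₂ → G → V₁} (h : IsIndHom k U α) {φ : G → V₂} (hφ : IsInd U φ)
    (g u : G) (hu : u ∈ U) : α (φ (g * u)) (g * u)⁻¹ = α (φ g) g⁻¹ := by
  rw [hφ g u hu, h.2.2 _ (U.inv_mem hu)]
  simp

theorem aux_out {α : V₂ → G → V₁} (h : IsIndHom k U α) {φ : G → V₂} (hφ : IsInd U φ)
    (g : G) : α (φ (g : G ⧸ U).out) (g : G ⧸ U).out⁻¹ = α (φ g) g⁻¹ := by
  obtain ⟨u, hu⟩ := QuotientGroup.mk_out_eq_mul U g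
  rw [hu]
  exact aux_coset U h hφ g u u.2

theorem aux_fin0 {φ : G → V₂} (hφ : FinSupp U φ) :
    (Function.support fun q : G ⧸ U => φ q.out).Finite := by
  obtain ⟨S, hS⟩ := hφ
  refine (S.finite_toSet.image (fun g : G => (g : G ⧸ U))).subset ?_
  intro q hq
  obtain ⟨s, hs, hsu⟩ := hS _ hq
  refine ⟨s, hs, ?_⟩
  have := QuotientGroup.eq.2 hsu
  simpa using this

theorem aux_fin {α : V₂ → G → V₁} (h : IsIndHom k U α) {φ : G → V₂} (hφ : IsCInd U φ) :
    (Function.support fun q : G ⧸ U => α (φ q.out) q.out⁻¹).Finite := by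
  refine (aux_fin0 U hφ.2).subset ?_
  intro q hq h0
  apply hq
  simp only at h0
  simp [h0, aux_zero U h]

theorem aux_equiv {α : V₂ → G → V₁} (h : IsIndHom k U α) (u : G) (hu : u ∈ U) {φ : G → V₂}
    (hφ : IsCInd U φ) : recMap U α (fun g => φ (u⁻¹ * g)) = u • recMap U α φ := by
  unfold recMap
  have h1 : u • (∑ᶠ q : G ⧸ U, α (φ q.out) q.out⁻¹)
      = ∑ᶠ q : G ⧸ U, u • α (φ q.out) q.out⁻¹ :=
    (DistribSMul.toAddMonoidHom V₁ u).map_finsum (aux_fin U h hφ)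
  have hφ' : IsInd U (fun g => φ (u⁻¹ * g)) := by
    intro g w hw
    simp only [← mul_assoc]
    exact hφ.1 _ w hw
  rw [h1]
  refine (finsum_eq_of_bijective (fun q : G ⧸ U => u • q) (MulAction.bijective u) ?_).symm
  intro q
  induction q using QuotientGroup.induction_on with
  | H g =>
    have e : u • (g : G ⧸ U) = ((u * g : G) : G ⧸ U) := rfl
    have := aux_out U h hφ' (u * g)
    rw [e, this, aux_out U h hφ.1]
    simp only [inv_mul_cancel_left, mul_inv_rev]
    rw [h.2.1 _ _ _ (U.inv_mem hu), inv_inv]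

variable {U} in
theorem charFn_pos {g h : G} {v : V₂} (hm : g⁻¹ * h ∈ U) :
    charFn U h v g = (g⁻¹ * h) • v := by
  unfold charFn
  rw [if_pos hm]

variable {U} in
theorem charFn_neg {g h : G} {v : V₂} (hm : ¬ g⁻¹ * h ∈ U) :
    charFn U h v g = 0 := by
  unfold charFn
  rw [if_neg hm]

theorem aux_char (g : G) (v : V₂) : IsCInd U (charFn U g v) := by
  refine ⟨?_, {g}, ?_⟩
  · intro x u hu
    have e : (x * u)⁻¹ * g = u⁻¹ * (x⁻¹ * g) := by group
    have m := U.mul_mem_cancel_left (U.inv_mem hu) (y := x⁻¹ * g)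
    by_cases hc : x⁻¹ * g ∈ U
    · rw [charFn_pos hc, charFn_pos (by rw [e]; exact m.2 hc), e, mul_smul]
    · rw [charFn_neg hc, charFn_neg (by rw [e]; exact fun h => hc (m.1 h)), smul_zero]
  · intro x hx
    refine ⟨g, by simp, ?_⟩
    by_contra hn
    apply hx
    have : ¬ x⁻¹ * g ∈ U := fun h => hn (by simpa using U.inv_mem h)
    simp [charFn, this]

theorem aux_inv {α : V₂ → G → V₁} (h : IsIndHom k U α) (v : V₂) (g : G) :
    α v g = recMap U α (charFn U g⁻¹ v) := by
  unfold recMap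
  rw [finsum_eq_single _ ((g⁻¹ : G) : G ⧸ U)]
  · rw [aux_out U h (aux_char U g⁻¹ v).1]
    simp [charFn, U.one_mem]
  · intro q hq
    have : ¬ (q.out⁻¹ * g⁻¹ ∈ U) := by
      intro hh
      apply hq
      have := QuotientGroup.eq.2 hh
      simpa using this
    simp [charFn, this, aux_zero U h]

theorem aux_lin {α : V₂ → G → V₁} (h : IsIndHom k U α) (c : k) {φ ψ : G → V₂}
    (hφ : IsCInd U φ) (hψ : IsCInd U ψ) :
    recMap U α (c • φ + ψ) = c • recMap U α φ + recMap U α ψ := by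
  unfold recMap
  rw [smul_finsum' c (aux_fin U h hφ), ← finsum_add_distrib _ (aux_fin U h hψ)]
  · simp [h.1]
  · refine (aux_fin U h hφ).subset ?_
    intro q hq h0
    apply hq
    simp only at h0
    simp [h0]

theorem aux_lin' (c : k) {α α' : V₂ → G → V₁} (h : IsIndHom k U α) (h' : IsIndHom k U α')
    {φ : G → V₂} (hφ : IsCInd U φ) :
    recMap U (c • α + α') φ = c • recMap U α φ + recMap U α' φ := by
  unfold recMap
  rw [smul_finsum' c (aux_fin U h hφ), ← finsum_add_distrib _ (aux_fin U h' hφ)]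
  · simp
  · refine (aux_fin U h hφ).subset ?_
    intro q hq h0
    apply hq
    simp only at h0
    simp [h0]

open Classical in
/-- restriction of a function to a finite set of cosets -/
noncomputable def auxRes (φ : G → V₂) (T : Finset (G ⧸ U)) : G → V₂ :=
  fun g => if (g : G ⧸ U) ∈ T then φ g else 0

theorem aux_res {φ : G → V₂} (hφ : IsCInd U φ) (T : Finset (G ⧸ U)) :
    IsCInd U (auxRes U φ T) := by
  refine ⟨?_, ?_⟩
  · intro g u hu
    have e : ((g * u : G) : G ⧸ U) = g := by
      simp [hu]
    by_cases hc : (g : G ⧸ U) ∈ T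
    · simp [auxRes, hc, e, hφ.1 g u hu]
    · simp [auxRes, hc, e]
  · obtain ⟨S, hS⟩ := hφ.2
    refine ⟨S, fun g hg => hS g ?_⟩
    intro h0
    apply hg
    simp [auxRes, h0]

theorem aux_char_out {φ : G → V₂} (hφ : IsInd U φ) (q : G ⧸ U) (g : G) :
    ((g : G ⧸ U) = q → charFn U q.out (φ q.out) g = φ g) ∧
    ((g : G ⧸ U) ≠ q → charFn U q.out (φ q.out) g = 0) := by
  constructor
  · rintro rfl
    obtain ⟨u, hu⟩ := QuotientGroup.mk_out_eq_mul U g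
    rw [hu, hφ g u u.2]
    simp [charFn]
  · intro hne
    have : ¬ (g⁻¹ * q.out ∈ U) := by
      intro hh
      apply hne
      have := QuotientGroup.eq.2 hh
      simpa using this
    simp [charFn, this]

theorem aux_surj (β : {f : G → V₂ // IsCInd U f} → V₁)
    (h1 : ∀ (c : k) (φ ψ ξ : {f : G → V₂ // IsCInd U f}),
            ξ.val = c • φ.val + ψ.val → β ξ = c • β φ + β ψ)
    (φ : {f : G → V₂ // IsCInd U f}) (T : Finset (G ⧸ U)) :
    β ⟨auxRes U φ.1 T, aux_res U φ.2 T⟩ =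
      ∑ q ∈ T, β ⟨charFn U q.out (φ.1 q.out), aux_char U _ _⟩ := by
  classical
  induction T using Finset.induction_on with
  | empty =>
    have := h1 (-1) ⟨auxRes U φ.1 ∅, aux_res U φ.2 ∅⟩ ⟨auxRes U φ.1 ∅, aux_res U φ.2 ∅⟩
      ⟨auxRes U φ.1 ∅, aux_res U φ.2 ∅⟩ (by ext; simp [auxRes])
    simpa using this
  | insert q T hq ih =>
    rw [Finset.sum_insert hq, ← ih]
    have := h1 1 ⟨charFn U q.out (φ.1 q.out), aux_char U _ _⟩
      ⟨auxRes U φ.1 T, aux_res U φ.2 T⟩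
      ⟨auxRes U φ.1 (insert q T), aux_res U φ.2 (insert q T)⟩ (by
        funext g
        obtain ⟨ha, hb⟩ := aux_char_out U φ.2.1 q g
        by_cases hg : (g : G ⧸ U) = q
        · simp [auxRes, ha hg, hg, hq]
        · simp [auxRes, hb hg, hg])
    simpa using this

end Aux

/-- The map `rec : Hom_U(V₂, Ind_U^G(V₁)) → Hom_U(ind_U^G(V₂), V₁)` is well defined and is
a `k`-linear bijection with inverse `rec⁻¹(β)(v)(g) = β (char_{g⁻¹,U}^v)`. -/
theorem stmt6 {k G V₁ V₂ : Type*} [Field k] [Group G] (U : Subgroup G)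
    [AddCommGroup V₁] [Module k V₁] [DistribMulAction G V₁] [SMulCommClass G k V₁]
    [AddCommGroup V₂] [Module k V₂] [DistribMulAction G V₂] [SMulCommClass G k V₂] :
    -- the summand depends only on the left coset of the representative
    (∀ α : V₂ → G → V₁, IsIndHom k U α → ∀ φ : G → V₂, IsCInd U φ →
        ∀ g : G, ∀ u ∈ U, α (φ (g * u)) (g * u)⁻¹ = α (φ g) g⁻¹) ∧
    -- only finitely many cosets contribute
    (∀ α : V₂ → G → V₁, IsIndHom k U α → ∀ φ : G → V₂, IsCInd U φ →
        (Function.support fun q : G ⧸ U => α (φ q.out) q.out⁻¹).Finite) ∧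
    -- `rec(α)` is `U`-equivariant
    (∀ α : V₂ → G → V₁, IsIndHom k U α → ∀ u ∈ U, ∀ φ : G → V₂, IsCInd U φ →
        recMap U α (fun g => φ (u⁻¹ * g)) = u • recMap U α φ) ∧
    -- `rec(α)` is `k`-linear
    (∀ α : V₂ → G → V₁, IsIndHom k U α → ∀ (c : k) (φ ψ : G → V₂),
        IsCInd U φ → IsCInd U ψ →
        recMap U α (c • φ + ψ) = c • recMap U α φ + recMap U α ψ) ∧
    -- `rec` itself is `k`-linear
    (∀ (c : k) (α α' : V₂ → G → V₁), IsIndHom k U α → IsIndHom k U α' →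
        ∀ φ : G → V₂, IsCInd U φ →
        recMap U (c • α + α') φ = c • recMap U α φ + recMap U α' φ) ∧
    -- the functions `char_{g⁻¹,U}^v` lie in `ind_U^G(V₂)`
    (∀ (g : G) (v : V₂), IsCInd U (charFn U g⁻¹ v)) ∧
    -- the inverse is given by `rec⁻¹(β)(v)(g) = β (char_{g⁻¹,U}^v)`
    (∀ α : V₂ → G → V₁, IsIndHom k U α → ∀ (v : V₂) (g : G),
        α v g = recMap U α (charFn U g⁻¹ v)) ∧
    -- `rec` is a bijection from `Hom_U(V₂, Ind_U^G(V₁))` onto `Hom_U(ind_U^G(V₂), V₁)`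
    Set.BijOn
      (fun (α : V₂ → G → V₁) (φ : {f : G → V₂ // IsCInd U f}) => recMap U α φ.val)
      {α | IsIndHom k U α}
      {β : {f : G → V₂ // IsCInd U f} → V₁ |
        (∀ (c : k) (φ ψ ξ : {f : G → V₂ // IsCInd U f}),
            ξ.val = c • φ.val + ψ.val → β ξ = c • β φ + β ψ) ∧
        (∀ u ∈ U, ∀ φ ψ : {f : G → V₂ // IsCInd U f},
            (∀ g : G, ψ.val g = φ.val (u⁻¹ * g)) → β ψ = u • β φ)} := by
  refine ⟨fun α h φ hφ g u hu => aux_coset U h hφ.1 g u hu,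
    fun α h φ hφ => aux_fin U h hφ,
    fun α h u hu φ hφ => aux_equiv U h u hu hφ,
    fun α h c φ ψ hφ hψ => aux_lin U h c hφ hψ,
    fun c α α' h h' φ hφ => aux_lin' U c h h' hφ,
    fun g v => aux_char U _ v,
    fun α h v g => aux_inv U h v g, ?_, ?_, ?_⟩
  · intro α h
    refine ⟨?_, ?_⟩
    · intro c φ ψ ξ hξ
      simp only [hξ]
      exact aux_lin U h c φ.2 ψ.2
    · intro u hu φ ψ hψ
      have : ψ.val = fun g => φ.val (u⁻¹ * g) := funext hψ
      simp only [this]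
      exact aux_equiv U h u hu φ.2
  · intro α h α' h' he
    funext v g
    rw [aux_inv U h, aux_inv U h']
    exact congrFun he ⟨_, aux_char U g⁻¹ v⟩
  · rintro β ⟨h1, h2⟩
    have hα : IsIndHom k U (fun (v : V₂) (g : G) => β ⟨charFn U g⁻¹ v, aux_char U _ _⟩) := by
      refine ⟨?_, ?_, ?_⟩
      · intro c x y
        funext g
        refine h1 c _ _ _ ?_
        funext z
        simp only [charFn, Pi.add_apply, Pi.smul_apply]
        split_ifs
        · rw [smul_add, smul_comm]
        · simp
      · intro x g u hu
        refine h2 _ (U.inv_mem hu) _ _ ?_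
        intro z
        have e : (u⁻¹⁻¹ * z)⁻¹ * g⁻¹ = z⁻¹ * (g * u)⁻¹ := by group
        change charFn U (g * u)⁻¹ x z = charFn U g⁻¹ x (u⁻¹⁻¹ * z)
        by_cases hc : z⁻¹ * (g * u)⁻¹ ∈ U
        · rw [charFn_pos hc, charFn_pos (by rw [e]; exact hc), e]
        · rw [charFn_neg hc, charFn_neg (by rw [e]; exact hc)]
      · intro u hu x g
        refine congrArg β (Subtype.ext ?_)
        funext z
        have e : z⁻¹ * (u⁻¹ * g)⁻¹ = z⁻¹ * g⁻¹ * u := by group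
        have m := U.mul_mem_cancel_right hu (y := z⁻¹ * g⁻¹)
        change charFn U g⁻¹ (u • x) z = charFn U (u⁻¹ * g)⁻¹ x z
        by_cases hc : z⁻¹ * g⁻¹ ∈ U
        · rw [charFn_pos hc, charFn_pos (by rw [e]; exact m.2 hc), e, mul_smul _ u x]
        · rw [charFn_neg hc, charFn_neg (by rw [e]; exact fun h => hc (m.1 h))]
    refine ⟨fun (v : V₂) (g : G) => β ⟨charFn U g⁻¹ v, aux_char U _ _⟩, hα, ?_⟩
    funext φ
    have hf := aux_fin0 U φ.2.2
    have hs := aux_surj U β h1 φ hf.toFinset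
    have e : (⟨auxRes U φ.1 hf.toFinset, aux_res U φ.2 _⟩ : {f : G → V₂ // IsCInd U f}) = φ := by
      apply Subtype.ext
      funext g
      simp only [auxRes]
      split_ifs with hg
      · rfl
      · obtain ⟨u, hu⟩ := QuotientGroup.mk_out_eq_mul U g
        simp only [Set.Finite.mem_toFinset, Function.mem_support, not_not] at hg
        rw [hu, φ.2.1 g u u.2] at hg
        exact ((smul_eq_zero_iff_eq _).1 hg).symm
    rw [e] at hs
    rw [hs]
    simp only [recMap, inv_inv]
    refine finsum_eq_sum_of_support_subset _ ?_
    intro q hq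
    have hq' := aux_fin U hα φ.2
    simp only [Set.Finite.coe_toFinset, Function.mem_support]
    intro h0
    apply hq
    have := congrFun (aux_zero U hα) (q.out⁻¹)
    simp only [inv_inv] at this
    simp only [h0]
    exact this
end

section
/- Let V₁ and V₂ be representations of G. The formula 𝒥'(λ)(φ) = Σ_{g ∈ G/U} g·(λ(char_{g⁻¹,U}^{g·φ(g)})) (the summand depending only on the left coset gU and vanishing for all but finitely many cosets) defines an involutive k-linear automorphism 𝒥' of Hom_U(ind_U^G(V₂), V₁), and it satisfies 𝒥' ∘ rec = rec ∘ 𝒥 on Hom_U(V₂, Ind_U^G(V₁)). -/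
/-- `lam : (G → V) → W` represents a `U`-equivariant `k`-linear map
`ind_U^G(V) → W` (its values off the compact induction are irrelevant). -/
def IsCIndHom (k : Type*) {G V W : Type*} [Semiring k] [Group G] (U : Subgroup G)
    [AddCommMonoid V] [Module k V] [SMul G V]
    [AddCommMonoid W] [Module k W] [SMul G W] (lam : (G → V) → W) : Prop :=
  (∀ (c : k) (φ ψ : G → V), IsCInd U φ → IsCInd U ψ →
      lam (c • φ + ψ) = c • lam φ + lam ψ) ∧
  (∀ u ∈ U, ∀ φ : G → V, IsCInd U φ → lam (fun g => φ (u⁻¹ * g)) = u • lam φ)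

/-- `𝒥'(λ)(φ) = Σ_{g ∈ G/U} g • λ(char_{g⁻¹,U}^{g • φ g})`, the sum running over
representatives of the left cosets of `U` in `G`. -/
noncomputable def J'map {G V W : Type*} [Group G] (U : Subgroup G)
    [Zero V] [SMul G V] [AddCommMonoid W] [SMul G W]
    (lam : (G → V) → W) (φ : G → V) : W :=
  ∑ᶠ q : G ⧸ U, q.out • lam (charFn U q.out⁻¹ (q.out • φ q.out))

section helpers
set_option linter.unusedSectionVars false
variable {k G V W : Type*} [Field k] [Group G] {U : Subgroup G}
    [AddCommGroup V] [Module k V] [DistribMulAction G V] [SMulCommClass G k V]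
    [AddCommGroup W] [Module k W] [DistribMulAction G W] [SMulCommClass G k W]

theorem hp_charFn_cind (h : G) (v : V) : IsCInd U (charFn U h v) := by
  refine ⟨fun g u hu => ?_, {h}, fun g hg => ⟨h, by simp, ?_⟩⟩
  · have e : (g * u)⁻¹ * h = u⁻¹ * (g⁻¹ * h) := by group
    have : (g * u)⁻¹ * h ∈ U ↔ g⁻¹ * h ∈ U := by
      rw [e]; exact U.mul_mem_cancel_left (U.inv_mem hu)
    by_cases hh : g⁻¹ * h ∈ U
    · simp only [charFn, if_pos hh, if_pos (this.2 hh), e, mul_smul]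
    · simp only [charFn, if_neg hh, if_neg (mt this.1 hh), smul_zero]
  · by_contra hn
    apply hg
    have : ¬ (g⁻¹ * h ∈ U) := fun hm => hn (by simpa using U.inv_mem hm)
    simp [charFn, this]

theorem hp_charFn_shift (h u : G) (hu : u ∈ U) (v : V) :
    charFn U (h * u) v = charFn U h (u • v) := by
  funext g
  have e : g⁻¹ * (h * u) = (g⁻¹ * h) * u := by group
  have : g⁻¹ * (h * u) ∈ U ↔ g⁻¹ * h ∈ U := by
    rw [e]; exact U.mul_mem_cancel_right hu
  by_cases hh : g⁻¹ * h ∈ U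
  · simp only [charFn, if_pos hh, if_pos (this.2 hh), e, mul_smul]
  · simp only [charFn, if_neg hh, if_neg (mt this.1 hh)]

theorem hp_charFn_left (h u : G) (v : V) :
    charFn U (u * h) v = fun g => charFn U h v (u⁻¹ * g) := by
  funext g
  have e : (u⁻¹ * g)⁻¹ * h = g⁻¹ * (u * h) := by group
  unfold charFn
  rw [e]

theorem hp_charFn_lin (h : G) (c : k) (v w : V) :
    charFn U h (c • v + w) = c • charFn U h v + charFn U h w := by
  funext g
  by_cases hh : g⁻¹ * h ∈ U
  · simp [charFn, hh, smul_add, smul_comm]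
  · simp [charFn, hh]

theorem hp_charFn_zero (h : G) : charFn U h (0 : V) = 0 := by
  funext g
  simp [charFn]

theorem hp_charFn_self (h : G) (v : V) : charFn U h v h = v := by
  simp [charFn]

theorem hp_zero : IsCInd U (0 : G → V) := by
  rw [← hp_charFn_zero (U := U) 1]; exact hp_charFn_cind _ _

theorem hp_add {f g : G → V} (hf : IsCInd U f) (hg : IsCInd U g) : IsCInd U (f + g) := by
  classical
  obtain ⟨hf, S, hS⟩ := hf
  obtain ⟨hg, T, hT⟩ := hg
  refine ⟨fun x u hu => by simp [hf x u hu, hg x u hu], S ∪ T, fun x hx => ?_⟩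
  by_cases h : f x = 0
  · obtain ⟨s, hs, h'⟩ := hT x (fun h0 => hx (by simp [h, h0]))
    exact ⟨s, Finset.mem_union_right _ hs, h'⟩
  · obtain ⟨s, hs, h'⟩ := hS x h
    exact ⟨s, Finset.mem_union_left _ hs, h'⟩

theorem hp_smul (c : k) {f : G → V} (hf : IsCInd U f) : IsCInd U (c • f) := by
  obtain ⟨hf, S, hS⟩ := hf
  refine ⟨fun x u hu => by simp [hf x u hu, smul_comm], S, fun x hx => hS x ?_⟩
  intro h; exact hx (by simp [h])

theorem hp_translate (u : G) {f : G → V} (hf : IsCInd U f) :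
    IsCInd U (fun g => f (u⁻¹ * g)) := by
  classical
  obtain ⟨hf, S, hS⟩ := hf
  refine ⟨fun x v hv => by simp only [← mul_assoc]; exact hf _ _ hv, S.image (u * ·), fun x hx => ?_⟩
  obtain ⟨s, hs, h'⟩ := hS _ hx
  exact ⟨u * s, Finset.mem_image_of_mem _ hs, by convert h' using 1; group⟩

theorem hp_fin {f : G → V} (hf : IsCInd U f) :
    {q : G ⧸ U | f q.out ≠ 0}.Finite := by
  classical
  obtain ⟨hf, S, hS⟩ := hf
  refine (S.image (fun g : G => (g : G ⧸ U))).finite_toSet.subset ?_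
  intro q hq
  obtain ⟨s, hs, h'⟩ := hS _ hq
  simp only [Finset.coe_image, Set.mem_image]
  refine ⟨s, hs, ?_⟩
  rw [← QuotientGroup.out_eq' q]
  exact QuotientGroup.eq.2 h'

theorem hp_out (h : G) : ∃ u ∈ U, (h : G ⧸ U).out = h * u := by
  obtain ⟨u, hu⟩ := QuotientGroup.mk_out_eq_mul U h
  exact ⟨u, u.2, hu⟩

theorem hp_finsum_single (F : G → W) (hF : ∀ g, ∀ u ∈ U, F (g * u) = F g) (h : G)
    (h0 : ∀ g, g⁻¹ * h ∉ U → F g = 0) : ∑ᶠ q : G ⧸ U, F q.out = F h := by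
  rw [finsum_eq_single _ (h : G ⧸ U)]
  · obtain ⟨u, hu, e⟩ := hp_out (U := U) h
    rw [e, hF _ _ hu]
  · intro q hq
    apply h0
    intro hm
    apply hq
    rw [← QuotientGroup.out_eq' q]
    exact QuotientGroup.eq.2 hm

theorem hp_finsum_shift (F : G → W) (hF : ∀ g, ∀ u ∈ U, F (g * u) = F g) (x : G) :
    ∑ᶠ q : G ⧸ U, F q.out = ∑ᶠ q : G ⧸ U, F (x * q.out) := by
  rw [← finsum_comp_equiv (MulAction.toPerm x : Equiv.Perm (G ⧸ U))]
  apply finsum_congr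
  intro q
  have : (MulAction.toPerm x : Equiv.Perm (G ⧸ U)) q = ((x * q.out : G) : G ⧸ U) := by
    conv_lhs => rw [← QuotientGroup.out_eq' q]
    rfl
  obtain ⟨u, hu, e⟩ := hp_out (U := U) (x * q.out)
  rw [this, e, hF _ _ hu]

theorem hp_lam_zero {lam : (G → V) → W} (hl : IsCIndHom k U lam) : lam 0 = 0 := by
  have := hl.1 1 0 0 hp_zero hp_zero
  simpa using this

theorem hp_lam_sum {lam : (G → V) → W} (hl : IsCIndHom k U lam) {ι : Type*} (T : Finset ι)
    (f : ι → G → V) (hf : ∀ i, IsCInd U (f i)) :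
    IsCInd U (∑ i ∈ T, f i) ∧ lam (∑ i ∈ T, f i) = ∑ i ∈ T, lam (f i) := by
  classical
  induction T using Finset.induction_on with
  | empty => simpa using ⟨hp_zero, hp_lam_zero hl⟩
  | insert a s ha ih =>
    rw [Finset.sum_insert ha, Finset.sum_insert ha]
    refine ⟨hp_add (hf a) ih.1, ?_⟩
    have := hl.1 1 _ _ (hf a) ih.1
    simpa [ih.2] using this

theorem hp_lam_eq {lam : (G → V) → W} (hl : IsCIndHom k U lam) {φ : G → V} (hφ : IsCInd U φ) :
    ∑ᶠ q : G ⧸ U, lam (charFn U q.out (φ q.out)) = lam φ := by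
  classical
  have hfin := hp_fin hφ
  have e : φ = ∑ q ∈ hfin.toFinset, charFn U q.out (φ q.out) := by
    funext g
    rw [Finset.sum_apply]
    have h1 : ∑ᶠ q : G ⧸ U, charFn U q.out (φ q.out) g = charFn U g (φ g) g := by
      apply hp_finsum_single (fun x => charFn U x (φ x) g)
      · intro x u hu
        rw [hp_charFn_shift _ _ hu, hφ.1 _ _ hu, smul_inv_smul]
      · intro x hx
        have : g⁻¹ * x ∉ U := fun h => hx (by simpa using U.inv_mem h)
        simp [charFn, this]
    rw [hp_charFn_self] at h1
    rw [← h1]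
    apply finsum_eq_sum_of_support_subset
    intro q hq
    simp only [Set.Finite.coe_toFinset, Set.mem_ofPred_eq]
    intro h0
    apply hq
    simp [h0, hp_charFn_zero]
  conv_rhs => rw [e, (hp_lam_sum hl _ _ (fun q => hp_charFn_cind _ _)).2]
  apply finsum_eq_sum_of_support_subset
  intro q hq
  simp only [Set.Finite.coe_toFinset, Set.mem_ofPred_eq]
  intro h0
  apply hq
  simp [h0, hp_charFn_zero, hp_lam_zero hl]

theorem hp_coset {lam : (G → V) → W} (hl : IsCIndHom k U lam) {φ : G → V} (hφ : IsCInd U φ)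
    (g u : G) (hu : u ∈ U) :
    (g * u) • lam (charFn U (g * u)⁻¹ ((g * u) • φ (g * u)))
            = g • lam (charFn U g⁻¹ (g • φ g)) := by
  rw [hφ.1 _ _ hu, mul_inv_rev, hp_charFn_left, hl.2 _ (U.inv_mem hu) _ (hp_charFn_cind _ _),
    mul_smul, smul_inv_smul, mul_smul, smul_inv_smul]

theorem hp_supp {lam : (G → V) → W} (hl : IsCIndHom k U lam) {φ : G → V} (hφ : IsCInd U φ) :
    (Function.support fun q : G ⧸ U =>
          q.out • lam (charFn U q.out⁻¹ (q.out • φ q.out))).Finite := by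
  refine (hp_fin hφ).subset ?_
  intro q hq h0
  apply hq
  simp [h0, hp_charFn_zero, hp_lam_zero hl]

theorem hp_hom {lam : (G → V) → W} (hl : IsCIndHom k U lam) : IsCIndHom k U (J'map U lam) := by
  refine ⟨fun c φ ψ hφ hψ => ?_, fun u hu φ hφ => ?_⟩
  · unfold J'map
    rw [smul_finsum' c (hp_supp hl hφ), ← finsum_add_distrib _ (hp_supp hl hψ)]
    · apply finsum_congr
      intro q
      simp only [Pi.add_apply, Pi.smul_apply, smul_add]
      rw [smul_comm q.out c (φ _), hp_charFn_lin,
        hl.1 _ _ _ (hp_charFn_cind _ _) (hp_charFn_cind _ _), smul_add, smul_comm]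
    · refine (hp_supp hl hφ).subset ?_
      intro q hq h0
      apply hq
      simp only at h0 ⊢
      rw [h0, smul_zero]
  · have hs := hp_finsum_shift
      (fun g => g • lam (charFn U g⁻¹ (g • (fun g => φ (u⁻¹ * g)) g)))
      (fun g v hv => hp_coset hl (hp_translate u hφ) g v hv) u
    unfold J'map
    refine hs.trans ?_
    rw [smul_finsum' u (hp_supp hl hφ)]
    apply finsum_congr
    intro q
    simp only
    rw [mul_inv_rev, hp_charFn_shift _ _ (U.inv_mem hu), inv_mul_cancel_left, mul_smul u q.out (φ _),
      inv_smul_smul, mul_smul]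

theorem hp_J'_char {lam : (G → V) → W} (hl : IsCIndHom k U lam) (h : G) (w : V) :
    J'map U lam (charFn U h w) = h • lam (charFn U h⁻¹ (h • w)) := by
  unfold J'map
  rw [hp_finsum_single (fun g => g • lam (charFn U g⁻¹ (g • charFn U h w g)))
    (fun g v hv => hp_coset hl (hp_charFn_cind h w) g v hv) h, hp_charFn_self]
  intro g hg
  have : charFn U h w g = 0 := by simp [charFn, hg]
  simp [this, hp_charFn_zero, hp_lam_zero hl]

theorem hp_rec_char {α : V → G → W} (hα : IsIndHom k U α) (h : G) (w : V) :
    recMap U α (charFn U h w) = α w h⁻¹ := by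
  unfold recMap
  have a0 : α 0 = 0 := by simpa using hα.1 1 0 0
  rw [hp_finsum_single (fun g => α (charFn U h w g) g⁻¹) ?_ h ?_, hp_charFn_self]
  · intro g u hu
    rw [(hp_charFn_cind h w).1 _ _ hu, hα.2.2 _ (U.inv_mem hu)]
    congr 1
    group
  · intro g hg
    have : charFn U h w g = 0 := by simp [charFn, hg]
    simp [this, a0]

end helpers

/-- The formula `𝒥'(λ)(φ) = Σ_{g ∈ G/U} g • λ(char_{g⁻¹,U}^{g • φ g})` defines an
involutive `k`-linear automorphism `𝒥'` of `Hom_U(ind_U^G(V₂), V₁)`, and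
`𝒥' ∘ rec = rec ∘ 𝒥` on `Hom_U(V₂, Ind_U^G(V₁))`. -/
theorem stmt7 {k G V₁ V₂ : Type*} [Field k] [Group G] (U : Subgroup G)
    [AddCommGroup V₁] [Module k V₁] [DistribMulAction G V₁] [SMulCommClass G k V₁]
    [AddCommGroup V₂] [Module k V₂] [DistribMulAction G V₂] [SMulCommClass G k V₂] :
    -- the summand depends only on the left coset of the representative
    (∀ lam : (G → V₂) → V₁, IsCIndHom k U lam → ∀ φ : G → V₂, IsCInd U φ →
        ∀ g : G, ∀ u ∈ U,
          (g * u) • lam (charFn U (g * u)⁻¹ ((g * u) • φ (g * u)))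
            = g • lam (charFn U g⁻¹ (g • φ g))) ∧
    -- only finitely many cosets contribute
    (∀ lam : (G → V₂) → V₁, IsCIndHom k U lam → ∀ φ : G → V₂, IsCInd U φ →
        (Function.support fun q : G ⧸ U =>
          q.out • lam (charFn U q.out⁻¹ (q.out • φ q.out))).Finite) ∧
    -- `𝒥'` maps `Hom_U(ind_U^G(V₂), V₁)` to itself
    (∀ lam : (G → V₂) → V₁, IsCIndHom k U lam → IsCIndHom k U (J'map U lam)) ∧
    -- `𝒥'` is `k`-linear
    (∀ (c : k) (lam mu : (G → V₂) → V₁), IsCIndHom k U lam → IsCIndHom k U mu →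
        ∀ φ : G → V₂, IsCInd U φ →
          J'map U (c • lam + mu) φ = c • J'map U lam φ + J'map U mu φ) ∧
    -- `𝒥'` is involutive
    (∀ lam : (G → V₂) → V₁, IsCIndHom k U lam → ∀ φ : G → V₂, IsCInd U φ →
        J'map U (J'map U lam) φ = lam φ) ∧
    -- `𝒥' ∘ rec = rec ∘ 𝒥`
    (∀ α : V₂ → G → V₁, IsIndHom k U α → ∀ φ : G → V₂, IsCInd U φ →
        J'map U (recMap U α) φ = recMap U (Jmap α) φ) := by
  refine ⟨fun lam hl φ hφ g u hu => hp_coset hl hφ g u hu, fun lam hl φ hφ => hp_supp hl hφ,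
    fun lam hl => hp_hom hl, fun c lam mu hl hm φ hφ => ?_, fun lam hl φ hφ => ?_,
    fun α hα φ hφ => ?_⟩
  · unfold J'map
    rw [smul_finsum' c (hp_supp hl hφ), ← finsum_add_distrib _ (hp_supp hm hφ)]
    · apply finsum_congr
      intro q
      simp only [Pi.add_apply, Pi.smul_apply, smul_add]
      rw [smul_comm]
    · refine (hp_supp hl hφ).subset ?_
      intro q hq h0
      apply hq
      simp only at h0 ⊢
      rw [h0, smul_zero]
  · rw [← hp_lam_eq hl hφ]
    refine finsum_congr fun q => ?_
    rw [hp_J'_char hl, smul_inv_smul, inv_inv, inv_smul_smul]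
  · unfold J'map
    conv_rhs => unfold recMap
    apply finsum_congr
    intro q
    rw [hp_rec_char hα]
    simp only [Jmap, inv_inv]
end

section
/- Let V be a representation of G, and let X_U ⊗_k X_U carry the diagonal G-action. For every G-equivariant k-linear map Λ : X_U ⊗_k X_U → V, the assignment char_{gU} ↦ Λ(char_U ⊗ char_{gU}) extends uniquely to a k-linear map λ_Λ : X_U → V, and λ_Λ is U-equivariant. The map Λ ↦ λ_Λ is a k-linear bijection from Hom_G(X_U ⊗_k X_U, V) onto Hom_U(X_U, V), and it satisfies 𝒥'(λ_Λ) = λ_{Λ∘ς}, where ς : X_U ⊗_k X_U → X_U ⊗_k X_U is the swap of the two tensor factors. -/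
open scoped TensorProduct

/-- `X_U = ind_U^G(k)`, the compact induction of the trivial one-dimensional
representation of `U`, as a submodule of `G → k`: functions that are constant on left
cosets of `U` and supported in finitely many of them. -/
def xu (k : Type*) {G : Type*} [Field k] [Group G] (U : Subgroup G) :
    Submodule k (G → k) where
  carrier := {f | (∀ g : G, ∀ u ∈ U, f (g * u) = f g) ∧ FinSupp U f}
  add_mem' := by
    intro a b ha hb
    classical
    obtain ⟨h₁, S₁, hS₁⟩ := ha
    obtain ⟨h₂, S₂, hS₂⟩ := hb
    refine ⟨fun g u hu => ?_, S₁ ∪ S₂, fun g hg => ?_⟩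
    · simp only [Pi.add_apply, h₁ g u hu, h₂ g u hu]
    · by_cases hz : a g = 0
      · have hb0 : b g ≠ 0 := by
          intro hb0
          exact hg (by simp [Pi.add_apply, hz, hb0])
        obtain ⟨s, hs, hsu⟩ := hS₂ g hb0
        exact ⟨s, Finset.mem_union_right _ hs, hsu⟩
      · obtain ⟨s, hs, hsu⟩ := hS₁ g hz
        exact ⟨s, Finset.mem_union_left _ hs, hsu⟩
  zero_mem' := ⟨fun g u _ => rfl, ∅, fun g hg => absurd rfl hg⟩
  smul_mem' := by
    intro c f hf
    classical
    obtain ⟨h₁, S, hS⟩ := hf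
    refine ⟨fun g u hu => ?_, S, fun g hg => ?_⟩
    · simp only [Pi.smul_apply, h₁ g u hu]
    · refine hS g fun h0 => hg ?_
      simp [Pi.smul_apply, h0]

open Classical in
/-- The characteristic function `char_{gU} ∈ X_U` of the left coset `gU`. -/
noncomputable def charU (k : Type*) {G : Type*} [Field k] [Group G] (U : Subgroup G)
    (g : G) : xu k U :=
  ⟨fun x => if x⁻¹ * g ∈ U then (1 : k) else 0, by
    refine ⟨fun x u hu => ?_, {g}, fun x hx => ?_⟩
    · have hiff : (x * u)⁻¹ * g ∈ U ↔ x⁻¹ * g ∈ U := by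
        rw [mul_inv_rev, mul_assoc]
        exact U.mul_mem_cancel_left (U.inv_mem hu)
      simp only [hiff]
    · by_cases hc : x⁻¹ * g ∈ U
      · refine ⟨g, Finset.mem_singleton_self g, ?_⟩
        simpa [mul_inv_rev] using U.inv_mem hc
      · exfalso
        apply hx
        simp [hc]⟩

/-- The translation action of `g ∈ G` on `X_U`, `(g • f) x = f (g⁻¹ * x)`. -/
def transXU {k : Type*} {G : Type*} [Field k] [Group G] (U : Subgroup G) (g : G)
    (f : xu k U) : xu k U :=
  ⟨fun x => (f : G → k) (g⁻¹ * x), by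
    classical
    obtain ⟨h₁, S, hS⟩ := f.2
    refine ⟨fun x u hu => ?_, S.image (fun s => g * s), fun x hx => ?_⟩
    · show (f : G → k) (g⁻¹ * (x * u)) = (f : G → k) (g⁻¹ * x)
      rw [← mul_assoc]
      exact h₁ (g⁻¹ * x) u hu
    · obtain ⟨s, hs, hsu⟩ := hS (g⁻¹ * x) hx
      refine ⟨g * s, Finset.mem_image_of_mem _ hs, ?_⟩
      simpa [mul_inv_rev, mul_assoc] using hsu⟩


/-- `𝒥'` on `Hom_U(X_U, V)`:
`𝒥'(λ)(φ) = Σ_{g ∈ G/U} g • λ(φ(g) • char_{g⁻¹ U})`, the sum running over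
representatives of the left cosets of `U` in `G` (for the trivial coefficient
representation `k`, one has `char_{g⁻¹,U}^{g • φ g} = φ(g) • char_{g⁻¹ U}`). -/
noncomputable def J'xu {k : Type*} {G V : Type*} [Field k] [Group G] (U : Subgroup G)
    [AddCommMonoid V] [SMul G V] (lam : xu k U → V) (φ : xu k U) : V :=
  ∑ᶠ q : G ⧸ U, q.out • lam ((φ : G → k) q.out • charU k U q.out⁻¹)


theorem charU_apply_aux {k G : Type*} [Field k] [Group G] (U : Subgroup G) (g x : G) [Decidable (x⁻¹ * g ∈ U)] :
    (charU k U g : G → k) x = if x⁻¹ * g ∈ U then (1 : k) else 0 := by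
  simp only [charU]
  congr

/-- translation as a linear map -/
def transL (k : Type*) {G : Type*} [Field k] [Group G] (U : Subgroup G) (g : G) :
    xu k U →ₗ[k] xu k U where
  toFun := transXU U g
  map_add' _ _ := rfl
  map_smul' _ _ := rfl

theorem trans_charU {k G : Type*} [Field k] [Group G] (U : Subgroup G) (g h : G) :
    transXU U g (charU k U h) = charU k U (g * h) := by
  classical
  apply Subtype.ext
  funext x
  show (charU k U h : G → k) (g⁻¹ * x) = (charU k U (g * h) : G → k) x
  simp only [charU_apply_aux, mul_inv_rev, inv_inv, mul_assoc]

theorem trans_trans {k G : Type*} [Field k] [Group G] (U : Subgroup G) (g h : G) (x : xu k U) :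
    transXU U g (transXU U h x) = transXU U (g * h) x := by
  apply Subtype.ext
  funext y
  show (x : G → k) (h⁻¹ * (g⁻¹ * y)) = (x : G → k) ((g * h)⁻¹ * y)
  simp only [mul_inv_rev, mul_assoc]

theorem trans_one {k G : Type*} [Field k] [Group G] (U : Subgroup G) (x : xu k U) :
    transXU U 1 x = x := by
  apply Subtype.ext
  funext y
  show (x : G → k) (1⁻¹ * y) = (x : G → k) y
  simp

theorem charU_mul_mem {k G : Type*} [Field k] [Group G] (U : Subgroup G) (g u : G) (hu : u ∈ U) :
    charU k U (g * u) = charU k U g := by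
  classical
  apply Subtype.ext
  funext x
  simp only [charU_apply_aux, ← mul_assoc, U.mul_mem_cancel_right hu]

theorem out_eq {G : Type*} [Group G] (U : Subgroup G) (g : G) :
    ∃ u ∈ U, (QuotientGroup.mk g : G ⧸ U).out = g * u := by
  obtain ⟨u, hu⟩ := QuotientGroup.mk_out_eq_mul U g
  exact ⟨u, u.2, hu⟩

theorem xu_out {k G : Type*} [Field k] [Group G] (U : Subgroup G) (φ : xu k U) (g : G) :
    (φ : G → k) (QuotientGroup.mk g : G ⧸ U).out = (φ : G → k) g := by
  obtain ⟨u, hu, h⟩ := out_eq U g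
  rw [h]
  exact φ.2.1 g u hu

theorem xu_fin {k G : Type*} [Field k] [Group G] (U : Subgroup G) (φ : xu k U) :
    (Function.support fun q : G ⧸ U => (φ : G → k) q.out).Finite := by
  obtain ⟨S, hS⟩ := φ.2.2
  refine (S.finite_toSet.image (fun g => (QuotientGroup.mk g : G ⧸ U))).subset ?_
  intro q hq
  obtain ⟨s, hs, h⟩ := hS _ hq
  refine ⟨s, hs, ?_⟩
  have := (QuotientGroup.eq (s := U)).2 h
  simpa using this

/-- coordinates -/
noncomputable def coordU (k : Type*) {G : Type*} [Field k] [Group G] (U : Subgroup G) :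
    xu k U →ₗ[k] (G ⧸ U →₀ k) where
  toFun φ := Finsupp.ofSupportFinite (fun q => (φ : G → k) q.out) (xu_fin U φ)
  map_add' _ _ := by ext; rfl
  map_smul' _ _ := by ext; rfl

theorem coordU_apply {k G : Type*} [Field k] [Group G] (U : Subgroup G) (φ : xu k U) (q : G ⧸ U) :
    coordU k U φ q = (φ : G → k) q.out := rfl

theorem coordU_charU {k G : Type*} [Field k] [Group G] (U : Subgroup G) (g : G) :
    coordU k U (charU k U g) = Finsupp.single (QuotientGroup.mk g) 1 := by
  classical
  ext q
  rw [coordU_apply, charU_apply_aux, Finsupp.single_apply]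
  congr 1
  rw [← QuotientGroup.eq, QuotientGroup.out_eq']
  exact propext eq_comm

theorem coordU_inj {k G : Type*} [Field k] [Group G] (U : Subgroup G) :
    Function.Injective (coordU k U) := by
  intro a b h
  apply Subtype.ext
  funext g
  rw [← xu_out U a, ← xu_out U b, ← coordU_apply, ← coordU_apply, h]

theorem xu_repr {k G : Type*} [Field k] [Group G] (U : Subgroup G) (φ : xu k U) :
    Finsupp.linearCombination k (fun q : G ⧸ U => charU k U q.out) (coordU k U φ) = φ := by
  apply coordU_inj U
  rw [Finsupp.apply_linearCombination]
  have : (⇑(coordU k U) ∘ fun q : G ⧸ U => charU k U q.out) = fun q => Finsupp.single q 1 := by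
    funext q
    simp [coordU_charU]
  rw [this]
  ext q
  simp [Finsupp.linearCombination_apply]

theorem xu_hom_ext {k G W : Type*} [Field k] [Group G] (U : Subgroup G) [AddCommGroup W]
    [Module k W] (a b : xu k U →ₗ[k] W) (h : ∀ g, a (charU k U g) = b (charU k U g)) : a = b := by
  ext φ
  rw [← xu_repr U φ, Finsupp.apply_linearCombination, Finsupp.apply_linearCombination]
  congr 2
  funext q
  exact h _

/-- `g ∘ lam ∘ g⁻¹` -/
def conjL {k G V : Type*} [Field k] [Group G] (U : Subgroup G)
    [AddCommGroup V] [Module k V] [DistribMulAction G V] [SMulCommClass G k V]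
    (lam : xu k U →ₗ[k] V) (g : G) : xu k U →ₗ[k] V :=
  (DistribSMul.toLinearMap k V g).comp (lam.comp (transL k U g⁻¹))

theorem conjL_apply {k G V : Type*} [Field k] [Group G] (U : Subgroup G)
    [AddCommGroup V] [Module k V] [DistribMulAction G V] [SMulCommClass G k V]
    (lam : xu k U →ₗ[k] V) (g : G) (x : xu k U) :
    conjL U lam g x = g • lam (transXU U g⁻¹ x) := rfl

/-- inverse construction -/
noncomputable def invB {k G V : Type*} [Field k] [Group G] (U : Subgroup G)
    [AddCommGroup V] [Module k V] [DistribMulAction G V] [SMulCommClass G k V]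
    (lam : xu k U →ₗ[k] V) : xu k U →ₗ[k] xu k U →ₗ[k] V :=
  (Finsupp.linearCombination k (fun q : G ⧸ U => conjL U lam q.out)).comp (coordU k U)

theorem invB_charU {k G V : Type*} [Field k] [Group G] (U : Subgroup G)
    [AddCommGroup V] [Module k V] [DistribMulAction G V] [SMulCommClass G k V]
    (lam : xu k U →ₗ[k] V) (hl : ∀ u ∈ U, ∀ φ : xu k U, lam (transXU U u φ) = u • lam φ)
    (g : G) (y : xu k U) :
    invB U lam (charU k U g) y = g • lam (transXU U g⁻¹ y) := by
  rw [invB, LinearMap.comp_apply, coordU_charU, Finsupp.linearCombination_single, one_smul,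
    conjL_apply]
  obtain ⟨u, hu, h⟩ := out_eq U g
  rw [h, mul_inv_rev, ← trans_trans, hl _ (U.inv_mem hu), smul_smul]
  simp

theorem inv_equivariant {k G V : Type*} [Field k] [Group G] (U : Subgroup G)
    [AddCommGroup V] [Module k V] [DistribMulAction G V] [SMulCommClass G k V]
    (lam : xu k U →ₗ[k] V) (hl : ∀ u ∈ U, ∀ φ : xu k U, lam (transXU U u φ) = u • lam φ)
    (g : G) (x y : xu k U) :
    invB U lam (transXU U g x) (transXU U g y) = g • invB U lam x y := by
  have := xu_hom_ext U (((invB U lam).flip (transXU U g y)).comp (transL k U g))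
    ((DistribSMul.toLinearMap k V g).comp ((invB U lam).flip y)) ?_
  · exact LinearMap.congr_fun this x
  · intro h
    show invB U lam (transXU U g (charU k U h)) (transXU U g y) = g • invB U lam (charU k U h) y
    rw [trans_charU, invB_charU U lam hl, invB_charU U lam hl, trans_trans, smul_smul]
    simp

/-- For every `G`-equivariant `k`-linear map `Λ : X_U ⊗_k X_U → V` (diagonal `G`-action
on the source), the assignment `char_{gU} ↦ Λ(char_U ⊗ char_{gU})` extends uniquely to a
`k`-linear map `λ_Λ : X_U → V`, given by `λ_Λ = Λ(char_U ⊗ -)`; `λ_Λ` is `U`-equivariant;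
`Λ ↦ λ_Λ` is a `k`-linear bijection `Hom_G(X_U ⊗_k X_U, V) → Hom_U(X_U, V)`; and
`𝒥'(λ_Λ) = λ_{Λ∘ς}` where `ς` swaps the two tensor factors. -/
theorem stmt9 {k G V : Type*} [Field k] [Group G] (U : Subgroup G)
    [AddCommGroup V] [Module k V] [DistribMulAction G V] [SMulCommClass G k V] :
    (∀ Λ : xu k U ⊗[k] xu k U →ₗ[k] V,
      (∀ (g : G) (x y : xu k U),
          Λ (transXU U g x ⊗ₜ[k] transXU U g y) = g • Λ (x ⊗ₜ[k] y)) →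
      -- unique linear extension of `char_{gU} ↦ Λ(char_U ⊗ char_{gU})`
      (∃! lam : xu k U →ₗ[k] V, ∀ g : G,
          lam (charU k U g) = Λ (charU k U 1 ⊗ₜ[k] charU k U g)) ∧
      -- `λ_Λ = Λ(char_U ⊗ -)` realizes these values
      (∀ g : G,
          (Λ.comp ((TensorProduct.mk k (xu k U) (xu k U)) (charU k U 1))) (charU k U g)
            = Λ (charU k U 1 ⊗ₜ[k] charU k U g)) ∧
      -- `λ_Λ` is `U`-equivariant
      (∀ u ∈ U, ∀ φ : xu k U,
          (Λ.comp ((TensorProduct.mk k (xu k U) (xu k U)) (charU k U 1))) (transXU U u φ)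
            = u • (Λ.comp ((TensorProduct.mk k (xu k U) (xu k U)) (charU k U 1))) φ) ∧
      -- `𝒥'(λ_Λ) = λ_{Λ∘ς}`
      (∀ φ : xu k U,
          J'xu U (fun x => Λ (charU k U 1 ⊗ₜ[k] x)) φ = Λ (φ ⊗ₜ[k] charU k U 1))) ∧
    -- `Λ ↦ λ_Λ` is `k`-linear
    (∀ (c : k) (Λ Λ' : xu k U ⊗[k] xu k U →ₗ[k] V) (φ : xu k U),
        ((c • Λ + Λ').comp ((TensorProduct.mk k (xu k U) (xu k U)) (charU k U 1))) φ
          = c • (Λ.comp ((TensorProduct.mk k (xu k U) (xu k U)) (charU k U 1))) φ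
            + (Λ'.comp ((TensorProduct.mk k (xu k U) (xu k U)) (charU k U 1))) φ) ∧
    -- `Λ ↦ λ_Λ` is a bijection `Hom_G(X_U ⊗_k X_U, V) → Hom_U(X_U, V)`
    Set.BijOn
      (fun Λ : xu k U ⊗[k] xu k U →ₗ[k] V =>
        Λ.comp ((TensorProduct.mk k (xu k U) (xu k U)) (charU k U 1)))
      {Λ | ∀ (g : G) (x y : xu k U),
          Λ (transXU U g x ⊗ₜ[k] transXU U g y) = g • Λ (x ⊗ₜ[k] y)}
      {lam : xu k U →ₗ[k] V | ∀ u ∈ U, ∀ φ : xu k U,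
          lam (transXU U u φ) = u • lam φ} := by
  have hU : ∀ u ∈ U, transXU U u (charU k U 1) = charU k U 1 := by
    intro u hu
    rw [trans_charU, mul_one, ← one_mul u, charU_mul_mem U 1 u hu]
  have hequi : ∀ Λ : xu k U ⊗[k] xu k U →ₗ[k] V,
      (∀ (g : G) (x y : xu k U),
          Λ (transXU U g x ⊗ₜ[k] transXU U g y) = g • Λ (x ⊗ₜ[k] y)) →
      ∀ u ∈ U, ∀ φ : xu k U,
          (Λ.comp ((TensorProduct.mk k (xu k U) (xu k U)) (charU k U 1))) (transXU U u φ)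
            = u • (Λ.comp ((TensorProduct.mk k (xu k U) (xu k U)) (charU k U 1))) φ := by
    intro Λ hΛ u hu φ
    have := hΛ u (charU k U 1) φ
    rw [hU u hu] at this
    exact this
  refine ⟨fun Λ hΛ => ⟨?_, fun _ => rfl, hequi Λ hΛ, ?_⟩, fun _ _ _ _ => rfl, ?_, ?_, ?_⟩
  · refine ⟨Λ.comp ((TensorProduct.mk k (xu k U) (xu k U)) (charU k U 1)), fun _ => rfl, ?_⟩
    intro l hl
    exact xu_hom_ext U _ _ hl
  · intro φ
    have key : ∀ q : G ⧸ U,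
        q.out • Λ (charU k U 1 ⊗ₜ[k] ((φ : G → k) q.out • charU k U q.out⁻¹))
          = coordU k U φ q • Λ (charU k U q.out ⊗ₜ[k] charU k U 1) := by
      intro q
      rw [TensorProduct.tmul_smul, map_smul, smul_comm, ← hΛ, trans_charU, trans_charU]
      simp [coordU_apply]
    unfold J'xu
    rw [finsum_congr key]
    conv_rhs => rw [← xu_repr U φ]
    rw [finsum_eq_sum_of_support_subset (s := (coordU k U φ).support)]
    · rw [Finsupp.linearCombination_apply, Finsupp.sum, TensorProduct.sum_tmul, map_sum]
      refine Finset.sum_congr rfl fun q _ => ?_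
      rw [← TensorProduct.smul_tmul', map_smul]
    · intro q hq
      simp only [Finset.mem_coe, Finsupp.mem_support_iff]
      intro h0
      exact hq (by simp [h0])
  · intro Λ hΛ
    exact hequi Λ hΛ
  · intro Λ hΛ Λ' hΛ' h
    apply TensorProduct.ext
    apply xu_hom_ext U
    intro g
    ext y
    show Λ (charU k U g ⊗ₜ[k] y) = Λ' (charU k U g ⊗ₜ[k] y)
    have e1 : charU k U g = transXU U g (charU k U 1) := by rw [trans_charU, mul_one]
    have e2 : y = transXU U g (transXU U g⁻¹ y) := by
      rw [trans_trans, mul_inv_cancel, trans_one]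
    rw [e1, e2, hΛ, hΛ']
    exact congrArg (g • ·) (LinearMap.congr_fun h (transXU U g⁻¹ y))
  · intro lam hl
    refine ⟨TensorProduct.lift (invB U lam), ?_, ?_⟩
    · intro g x y
      simp only [TensorProduct.lift.tmul]
      exact inv_equivariant U lam hl g x y
    · apply LinearMap.ext
      intro y
      show invB U lam (charU k U 1) y = lam y
      rw [invB_charU U lam hl, inv_one, trans_one, one_smul]
end

section
/- Let V₁ and V₂ be representations of G, let φ ∈ ind_U^G(V₁) and D ∈ Hom_U(V₁, Ind_U^G(V₂)). Then the function ⟨φ, D⟩ : G → V₂ defined by ⟨φ, D⟩(g) = D(g·φ(g))(g) belongs to ind_U^G(V₂), its support is contained in the support of φ, and for fixed D the map φ ↦ ⟨φ, D⟩ is a U-equivariant k-linear map ind_U^G(V₁) → ind_U^G(V₂), i.e. ⟨u·φ, D⟩ = u·⟨φ, D⟩ for all u ∈ U. -/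
/-- The pairing `⟨φ, D⟩(g) = D (g • φ g) g`. -/
def pairFn {G V₁ V₂ : Type*} [Group G] [SMul G V₁] (D : V₁ → G → V₂) (φ : G → V₁) :
    G → V₂ :=
  fun g => D (g • φ g) g

/-- For `φ ∈ ind_U^G(V₁)` and `D ∈ Hom_U(V₁, Ind_U^G(V₂))`, the function `⟨φ, D⟩` lies in
`ind_U^G(V₂)`, its support is contained in the support of `φ`, and `φ ↦ ⟨φ, D⟩` is a
`U`-equivariant `k`-linear map `ind_U^G(V₁) → ind_U^G(V₂)`. -/
theorem stmt10 {k G V₁ V₂ : Type*} [Field k] [Group G] (U : Subgroup G)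
    [AddCommGroup V₁] [Module k V₁] [DistribMulAction G V₁] [SMulCommClass G k V₁]
    [AddCommGroup V₂] [Module k V₂] [DistribMulAction G V₂] [SMulCommClass G k V₂]
    (D : V₁ → G → V₂) (hD : IsIndHom k U D)
    (φ : G → V₁) (hφ : IsCInd U φ) :
    -- `⟨φ, D⟩` satisfies the transformation rule of `Ind_U^G(V₂)`
    IsInd U (pairFn D φ) ∧
    -- its support is contained in that of `φ`
    (∀ g : G, pairFn D φ g ≠ 0 → φ g ≠ 0) ∧
    -- in particular `⟨φ, D⟩ ∈ ind_U^G(V₂)`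
    IsCInd U (pairFn D φ) ∧
    -- `φ ↦ ⟨φ, D⟩` is `U`-equivariant
    (∀ u ∈ U, pairFn D (fun g => φ (u⁻¹ * g)) = fun g => pairFn D φ (u⁻¹ * g)) ∧
    -- and `k`-linear
    (∀ (c : k) (ψ : G → V₁), IsCInd U ψ →
        pairFn D (c • φ + ψ) = c • pairFn D φ + pairFn D ψ) := by
  obtain ⟨hlin, hind, heq⟩ := hD
  obtain ⟨hφ1, S, hS⟩ := hφ
  have h0 : D 0 = 0 := by
    have h := hlin 1 0 0
    simpa using h
  have h1 : IsInd U (pairFn D φ) := by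
    intro g u hu
    simp only [pairFn]
    rw [hφ1 g u hu, ← hind _ g u hu, smul_smul, mul_inv_cancel_right]
  have h2 : ∀ g : G, pairFn D φ g ≠ 0 → φ g ≠ 0 := by
    intro g hg h
    apply hg
    simp [pairFn, h, h0]
  refine ⟨h1, h2, ⟨h1, S, fun g hg => hS g (h2 g hg)⟩, ?_, ?_⟩
  · intro u hu
    funext g
    simp only [pairFn]
    rw [← heq u hu, smul_smul, mul_inv_cancel_left]
  · intro c ψ _
    funext g
    simp only [pairFn, Pi.add_apply, Pi.smul_apply]
    rw [smul_add, smul_comm g c, hlin]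
    rfl
end

section
/- Let V₁, V₂, V₃ be representations of G, with V₁ finitely generated as a U-representation. Then for every C ∈ Hom_U(ind_U^G(V₂), V₃) and every D ∈ Hom_U(V₁, ind_U^G(V₂)), the element ⟨C, D⟩ of Hom_U(ind_U^G(V₁), V₃) lies in Hom_U^{fin}(ind_U^G(V₁), V₃); that is, there exists a finite subset S ⊆ G such that ⟨C, D⟩(φ) = 0 for every φ ∈ ind_U^G(V₁) whose support is contained in G ∖ ⋃_{h∈S} UhU. -/
/-- If `V₁` is finitely generated as a `U`-representation, then for
`C ∈ Hom_U(ind_U^G(V₂), V₃)` and `D ∈ Hom_U(V₁, ind_U^G(V₂))` the element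
`⟨C, D⟩ = C ∘ ⟨-, D⟩` of `Hom_U(ind_U^G(V₁), V₃)` lies in
`Hom_U^{fin}(ind_U^G(V₁), V₃)`: there is a finite set `S ⊆ G` such that `⟨C, D⟩`
vanishes on every `φ ∈ ind_U^G(V₁)` supported outside `⋃_{h ∈ S} UhU`. -/
theorem stmt11 {k G V₁ V₂ V₃ : Type*} [Field k] [Group G] (U : Subgroup G)
    [AddCommGroup V₁] [Module k V₁] [DistribMulAction G V₁] [SMulCommClass G k V₁]
    [AddCommGroup V₂] [Module k V₂] [DistribMulAction G V₂] [SMulCommClass G k V₂]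
    [AddCommGroup V₃] [Module k V₃] [DistribMulAction G V₃] [SMulCommClass G k V₃]
    (hFG : ∃ T : Finset V₁,
      Submodule.span k {x : V₁ | ∃ t ∈ T, ∃ u ∈ U, x = u • t} = ⊤)
    (C : (G → V₂) → V₃) (hC : IsCIndHom k U C)
    (D : V₁ → G → V₂) (hD : IsIndHom k U D) (hDc : ∀ x, FinSupp U (D x)) :
    ∃ S : Finset G, ∀ φ : G → V₁, IsCInd U φ →
      (∀ g : G, φ g ≠ 0 → ∀ s ∈ S, g ∉ DCoset U s) →
      C (pairFn D φ) = 0 := by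
  classical
  obtain ⟨T, hT⟩ := hFG
  obtain ⟨hlin, hind, heq⟩ := hD
  choose F hF using hDc
  have hD0 : D 0 = 0 := by
    have h := hlin 1 0 0
    simpa using h
  have hC0 : C 0 = 0 := by
    have hz : IsCInd U (0 : G → V₂) :=
      ⟨fun g u _ => by simp, ∅, fun g hg => absurd rfl hg⟩
    have h := hC.1 1 0 0 hz hz
    simpa using h
  refine ⟨T.biUnion F, fun φ _ hφ => ?_⟩
  have key : ∀ g : G, (∀ s ∈ T.biUnion F, g ∉ DCoset U s) → ∀ x : V₁, D x g = 0 := by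
    intro g hg x
    have hx : x ∈ Submodule.span k {x : V₁ | ∃ t ∈ T, ∃ u ∈ U, x = u • t} := by
      rw [hT]; trivial
    induction hx using Submodule.span_induction with
    | mem x hx =>
      obtain ⟨t, ht, u, hu, rfl⟩ := hx
      rw [heq u hu]
      by_contra hne
      obtain ⟨s, hs, hsu⟩ := hF t _ hne
      exact hg s (Finset.mem_biUnion.2 ⟨t, ht, hs⟩) ⟨u, hu, _, hsu, by group⟩
    | zero => rw [hD0]; rfl
    | add x y _ _ hx hy =>
      have h := congrFun (hlin 1 x y) g
      simpa [hx, hy] using h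
    | smul c x _ hx =>
      have h := congrFun (hlin c x 0) g
      simpa [hx, hD0] using h
  have : pairFn D φ = 0 := by
    funext g
    by_cases h : φ g = 0
    · simp [pairFn, h, hD0]
    · exact key g (hφ g h) _
  rw [this, hC0]
end

section
/- Suppose every double coset UhU (h ∈ G) is a finite union of left cosets of U, and let V₁, V₃ be representations of G. Then for every F ∈ Hom_U^{fin}(ind_U^G(V₁), V₃) and v ∈ V₁, the summand F(char_{g,U}^{g⁻¹·v}) depends only on the left coset gU and vanishes for all but finitely many cosets, and Tr(F) : V₁ → V₃, Tr(F)(v) = Σ_{g ∈ G/U} F(char_{g,U}^{g⁻¹·v}), is a U-equivariant k-linear map; thus Tr is a k-linear map Hom_U^{fin}(ind_U^G(V₁), V₃) → Hom_U(V₁, V₃). -/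
/-- `F` represents an element of `Hom_U^{fin}(ind_U^G(V), W)`: there is a finite set
`S ⊆ G` such that `F` vanishes on every `φ ∈ ind_U^G(V)` supported outside
`⋃_{h ∈ S} UhU`. -/
def HomFinSupp {G V W : Type*} [Group G] (U : Subgroup G) [Zero V] [SMul G V] [Zero W]
    (F : (G → V) → W) : Prop :=
  ∃ S : Finset G, ∀ φ : G → V, IsCInd U φ →
    (∀ g : G, φ g ≠ 0 → ∀ s ∈ S, g ∉ DCoset U s) → F φ = 0

/-- The trace map `Tr(F)(v) = Σ_{g ∈ G/U} F (char_{g,U}^{g⁻¹ • v})`, the sum running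
over representatives of the left cosets of `U` in `G`. -/
noncomputable def trMap {G V W : Type*} [Group G] (U : Subgroup G)
    [Zero V] [SMul G V] [AddCommMonoid W] (F : (G → V) → W) (v : V) : W :=
  ∑ᶠ q : G ⧸ U, F (charFn U q.out (q.out⁻¹ • v))

theorem charFn_apply_aux {G V : Type*} [Group G] (U : Subgroup G) [AddCommGroup V]
    [DistribMulAction G V] (h : G) (v : V) (x : G) [Decidable (x⁻¹ * h ∈ U)] :
    charFn U h (h⁻¹ • v) x = if x⁻¹ * h ∈ U then x⁻¹ • v else 0 := by
  unfold charFn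
  by_cases hx : x⁻¹ * h ∈ U
  · simp [hx, smul_smul]
  · simp [hx]

theorem charFn_mul_aux {G V : Type*} [Group G] (U : Subgroup G) [AddCommGroup V]
    [DistribMulAction G V] (g u : G) (hu : u ∈ U) (v : V) :
    charFn U (g * u) ((g * u)⁻¹ • v) = charFn U g (g⁻¹ • v) := by
  classical
  funext x
  rw [charFn_apply_aux, charFn_apply_aux]
  simp only [← mul_assoc, U.mul_mem_cancel_right hu]

theorem charFn_isCInd_aux {G V : Type*} [Group G] (U : Subgroup G) [AddCommGroup V]
    [DistribMulAction G V] (h : G) (v : V) : IsCInd U (charFn U h v) := by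
  classical
  refine ⟨?_, {h}, ?_⟩
  · intro g u hu
    have : (g * u)⁻¹ * h ∈ U ↔ g⁻¹ * h ∈ U := by
      rw [mul_inv_rev, mul_assoc]
      exact U.mul_mem_cancel_left (U.inv_mem hu)
    unfold charFn
    by_cases hx : g⁻¹ * h ∈ U
    · rw [if_pos (this.mpr hx), if_pos hx, smul_smul, mul_inv_rev, mul_assoc]
    · simp only [this, hx, if_false, smul_zero]
  · intro g hg
    refine ⟨h, by simp, ?_⟩
    unfold charFn at hg
    by_cases hx : g⁻¹ * h ∈ U
    · simpa using U.inv_mem hx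
    · simp [hx] at hg

theorem charFn_linear_aux {k G V : Type*} [Field k] [Group G] (U : Subgroup G) [AddCommGroup V]
    [Module k V] [DistribMulAction G V] [SMulCommClass G k V] (h : G) (c : k) (v w : V) :
    charFn U h (h⁻¹ • (c • v + w)) = c • charFn U h (h⁻¹ • v) + charFn U h (h⁻¹ • w) := by
  classical
  funext x
  simp only [Pi.add_apply, Pi.smul_apply]
  rw [charFn_apply_aux, charFn_apply_aux, charFn_apply_aux]
  by_cases hx : x⁻¹ * h ∈ U
  · simp only [hx, if_true, smul_add, smul_comm x⁻¹ c v]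
  · simp [hx]

theorem charFn_trans_aux {G V : Type*} [Group G] (U : Subgroup G) [AddCommGroup V]
    [DistribMulAction G V] (g u : G) (v : V) :
    charFn U (u * g) ((u * g)⁻¹ • (u • v)) = fun x => charFn U g (g⁻¹ • v) (u⁻¹ * x) := by
  classical
  funext x
  rw [charFn_apply_aux, charFn_apply_aux]
  simp only [mul_inv_rev, inv_inv, mul_assoc, smul_smul]

/-- Suppose every double coset `UhU` is a finite union of left cosets of `U`.  For
`F ∈ Hom_U^{fin}(ind_U^G(V₁), V₃)` the sum defining `Tr(F)` makes sense (the summand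
depends only on the coset and vanishes for all but finitely many cosets) and
`Tr(F) : V₁ → V₃` is `U`-equivariant and `k`-linear; moreover `Tr` itself is `k`-linear.
-/
theorem stmt12 {k G V₁ V₃ : Type*} [Field k] [Group G] (U : Subgroup G)
    [AddCommGroup V₁] [Module k V₁] [DistribMulAction G V₁] [SMulCommClass G k V₁]
    [AddCommGroup V₃] [Module k V₃] [DistribMulAction G V₃] [SMulCommClass G k V₃]
    (hDC : ∀ h : G, ∃ S : Finset G, ∀ g ∈ DCoset U h, ∃ s ∈ S, s⁻¹ * g ∈ U) :
    -- the summand depends only on the left coset of the representative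
    (∀ F : (G → V₁) → V₃, IsCIndHom k U F → HomFinSupp U F →
      ∀ (v : V₁) (g : G), ∀ u ∈ U,
        F (charFn U (g * u) ((g * u)⁻¹ • v)) = F (charFn U g (g⁻¹ • v))) ∧
    -- only finitely many cosets contribute
    (∀ F : (G → V₁) → V₃, IsCIndHom k U F → HomFinSupp U F → ∀ v : V₁,
      (Function.support fun q : G ⧸ U => F (charFn U q.out (q.out⁻¹ • v))).Finite) ∧
    -- `Tr(F)` is `k`-linear
    (∀ F : (G → V₁) → V₃, IsCIndHom k U F → HomFinSupp U F →
      ∀ (c : k) (v w : V₁), trMap U F (c • v + w) = c • trMap U F v + trMap U F w) ∧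
    -- `Tr(F)` is `U`-equivariant
    (∀ F : (G → V₁) → V₃, IsCIndHom k U F → HomFinSupp U F →
      ∀ u ∈ U, ∀ v : V₁, trMap U F (u • v) = u • trMap U F v) ∧
    -- `Tr` is `k`-linear
    (∀ (c : k) (F F' : (G → V₁) → V₃),
      IsCIndHom k U F → HomFinSupp U F → IsCIndHom k U F' → HomFinSupp U F' →
      ∀ v : V₁, trMap U (c • F + F') v = c • trMap U F v + trMap U F' v) := by
  have h2 : ∀ F : (G → V₁) → V₃, HomFinSupp U F → ∀ v : V₁,
      (Function.support fun q : G ⧸ U => F (charFn U q.out (q.out⁻¹ • v))).Finite := by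
    classical
    rintro F ⟨S, hS⟩ v
    choose T hT using hDC
    refine ((S.biUnion T).image (fun g : G => (g : G ⧸ U))).finite_toSet.subset ?_
    intro q hq
    by_contra hcon
    refine hq (hS _ (charFn_isCInd_aux U _ _) ?_)
    intro g hg s hs hgs
    obtain ⟨t, ht, htg⟩ := hT s g hgs
    rw [charFn_apply_aux] at hg
    have hx : g⁻¹ * q.out ∈ U := by
      by_contra hx
      simp [hx] at hg
    apply hcon
    simp only [Finset.coe_image, Set.mem_image, Finset.mem_coe, Finset.mem_biUnion]
    refine ⟨t, ⟨s, hs, ht⟩, ?_⟩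
    rw [QuotientGroup.eq.mpr htg, QuotientGroup.eq.mpr hx, QuotientGroup.out_eq']
  refine ⟨?_, fun F _ hF => h2 F hF, ?_, ?_, ?_⟩
  · intro F _ _ v g u hu
    rw [charFn_mul_aux U g u hu]
  · intro F hF hfin c v w
    unfold trMap
    have hc : (Function.support fun q : G ⧸ U =>
        c • F (charFn U q.out (q.out⁻¹ • v))).Finite :=
      (h2 F hfin v).subset (Function.support_const_smul_subset c _)
    rw [smul_finsum' c (h2 F hfin v), ← finsum_add_distrib hc (h2 F hfin w)]
    refine finsum_congr fun q => ?_
    rw [charFn_linear_aux, hF.1 _ _ _ (charFn_isCInd_aux U _ _) (charFn_isCInd_aux U _ _)]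
  · intro F hF hfin u hu v
    unfold trMap
    have hm := (DistribSMul.toAddMonoidHom V₃ u).map_finsum (h2 F hfin v)
    simp only [DistribSMul.toAddMonoidHom_apply] at hm
    rw [hm, ← finsum_comp_equiv (MulAction.toPerm u : Equiv.Perm (G ⧸ U))]
    refine finsum_congr fun q => ?_
    rw [← hF.2 u hu _ (charFn_isCInd_aux U _ _), ← charFn_trans_aux]
    congr 1
    have hq : ((u * q.out : G) : G ⧸ U) = (((MulAction.toPerm u q : G ⧸ U).out : G) : G ⧸ U) := by
      rw [QuotientGroup.out_eq', MulAction.toPerm_apply]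
      conv_rhs => rw [← QuotientGroup.out_eq' q]
      rfl
    have := charFn_mul_aux U (u * q.out) _ (QuotientGroup.eq.mp hq) (u • v)
    rwa [mul_inv_cancel_left] at this
  · intro c F F' hF hfin hF' hfin' v
    unfold trMap
    have hc : (Function.support fun q : G ⧸ U =>
        c • F (charFn U q.out (q.out⁻¹ • v))).Finite :=
      (h2 F hfin v).subset (Function.support_const_smul_subset c _)
    rw [smul_finsum' c (h2 F hfin v), ← finsum_add_distrib hc (h2 F' hfin' v)]
    rfl
end

section
/- Suppose every double coset UhU (h ∈ G) is a finite union of left cosets of U. Let V₁, V₂, V₃ be representations of G, with V₁ finitely generated as a U-representation. Then for every C ∈ Hom_U(ind_U^G(V₂), V₃) and every D ∈ Hom_U(V₁, ind_U^G(V₂)) one has Tr(⟨C, D⟩) = C ∘ D in Hom_U(V₁, V₃). -/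
/-- Suppose every double coset `UhU` is a finite union of left cosets of `U`, and `V₁` is
finitely generated as a `U`-representation.  Then for `C ∈ Hom_U(ind_U^G(V₂), V₃)` and
`D ∈ Hom_U(V₁, ind_U^G(V₂))` one has `Tr(⟨C, D⟩) = C ∘ D` in `Hom_U(V₁, V₃)`. -/
theorem stmt13 {k G V₁ V₂ V₃ : Type*} [Field k] [Group G] (U : Subgroup G)
    [AddCommGroup V₁] [Module k V₁] [DistribMulAction G V₁] [SMulCommClass G k V₁]
    [AddCommGroup V₂] [Module k V₂] [DistribMulAction G V₂] [SMulCommClass G k V₂]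
    [AddCommGroup V₃] [Module k V₃] [DistribMulAction G V₃] [SMulCommClass G k V₃]
    (hDC : ∀ h : G, ∃ S : Finset G, ∀ g ∈ DCoset U h, ∃ s ∈ S, s⁻¹ * g ∈ U)
    (hFG : ∃ T : Finset V₁,
      Submodule.span k {x : V₁ | ∃ t ∈ T, ∃ u ∈ U, x = u • t} = ⊤)
    (C : (G → V₂) → V₃) (hC : IsCIndHom k U C)
    (D : V₁ → G → V₂) (hD : IsIndHom k U D) (hDc : ∀ x, FinSupp U (D x)) :
    ∀ v : V₁, trMap U (fun φ => C (pairFn D φ)) v = C (D v) := by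
  classical
  obtain ⟨hD1, hD2, hD3⟩ := hD
  obtain ⟨hC1, hC2⟩ := hC
  have hD0 : D 0 = 0 := by
    have h := hD1 1 0 0
    simpa using h
  have h0 : IsCInd U (0 : G → V₂) :=
    ⟨fun g u _ => by simp, ∅, fun g hg => absurd rfl hg⟩
  have hC0 : C 0 = 0 := by
    have h := hC1 1 0 0 h0 h0
    simpa using h
  intro v
  obtain ⟨S, hS⟩ := hDc v
  let r : G ⧸ U → G → V₂ := fun q g => if (g : G ⧸ U) = q then D v g else 0
  have hr : ∀ F : Finset (G ⧸ U), IsCInd U (∑ q ∈ F, r q) := by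
    intro F
    have e : ∀ g, (∑ q ∈ F, r q) g = if (g : G ⧸ U) ∈ F then D v g else 0 := by
      intro g
      simp [r, Finset.sum_apply]
    refine ⟨fun g u hu => ?_, S, fun g hg => hS g ?_⟩
    · rw [e, e, QuotientGroup.mk_mul_of_mem g hu]
      split_ifs
      · exact hD2 v g u hu
      · simp
    · intro h
      apply hg
      rw [e, h, ite_self]
  have hr1 : ∀ q, IsCInd U (r q) := fun q => by simpa using hr {q}
  have hsum : ∀ F : Finset (G ⧸ U), C (∑ q ∈ F, r q) = ∑ q ∈ F, C (r q) := by
    intro F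
    induction F using Finset.induction_on with
    | empty => simpa using hC0
    | insert a F ha ih =>
      rw [Finset.sum_insert ha, Finset.sum_insert ha, ← ih]
      have h := hC1 1 (r a) _ (hr1 a) (hr F)
      simpa using h
  have hp : ∀ q : G ⧸ U, pairFn D (charFn U q.out (q.out⁻¹ • v)) = r q := by
    intro q
    funext g
    have e : (g⁻¹ * q.out ∈ U) ↔ (g : G ⧸ U) = q := by
      rw [← QuotientGroup.eq, QuotientGroup.out_eq']
    simp only [pairFn, charFn, r, e]
    split_ifs
    · simp [smul_smul, mul_assoc]
    · simp [hD0]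
  let F : Finset (G ⧸ U) := S.image (fun g : G => (QuotientGroup.mk g : G ⧸ U))
  have hF : ∀ g, D v g ≠ 0 → (g : G ⧸ U) ∈ F := by
    intro g hg
    obtain ⟨s, hs, hsg⟩ := hS g hg
    exact Finset.mem_image.2 ⟨s, hs, QuotientGroup.eq.2 hsg⟩
  have hz : ∀ q, q ∉ F → r q = 0 := by
    intro q hq
    funext g
    by_contra h
    by_cases h1 : (g : G ⧸ U) = q
    · apply hq
      rw [← h1]
      apply hF
      simpa [r, h1] using h
    · simp [r, h1] at h
  have hDv : ∑ q ∈ F, r q = D v := by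
    funext g
    have e : (∑ q ∈ F, r q) g = if (g : G ⧸ U) ∈ F then D v g else 0 := by
      simp [r, Finset.sum_apply]
    rw [e]
    split_ifs with h
    · rfl
    · by_contra h2
      exact h (hF g (fun h3 => h2 h3.symm))
  unfold trMap
  simp only [hp]
  rw [finsum_eq_sum_of_support_subset (s := F), ← hsum, hDv]
  intro q hq
  by_contra h
  apply hq
  show C (r q) = 0
  rw [hz q (by simpa using h), hC0]
end

section
/- Let V₁, V₂, V₃ be representations of G, with V₁ finitely generated as a U-representation. Then for every F ∈ Hom_U(ind_U^G(V₂), V₃) and every β ∈ Hom_U(V₁, ind_U^G(V₂)) one has ⟨𝒥'(F), β⟩ = 𝒥'(⟨F, 𝒥(β)⟩) in Hom_U(ind_U^G(V₁), V₃). -/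
/-- If `V₁` is finitely generated as a `U`-representation, then for every
`F ∈ Hom_U(ind_U^G(V₂), V₃)` and every `β ∈ Hom_U(V₁, ind_U^G(V₂))` one has
`⟨𝒥'(F), β⟩ = 𝒥'(⟨F, 𝒥(β)⟩)` in `Hom_U(ind_U^G(V₁), V₃)`. -/
theorem stmt14 {k G V₁ V₂ V₃ : Type*} [Field k] [Group G] (U : Subgroup G)
    [AddCommGroup V₁] [Module k V₁] [DistribMulAction G V₁] [SMulCommClass G k V₁]
    [AddCommGroup V₂] [Module k V₂] [DistribMulAction G V₂] [SMulCommClass G k V₂]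
    [AddCommGroup V₃] [Module k V₃] [DistribMulAction G V₃] [SMulCommClass G k V₃]
    (hFG : ∃ T : Finset V₁,
      Submodule.span k {x : V₁ | ∃ t ∈ T, ∃ u ∈ U, x = u • t} = ⊤)
    (F : (G → V₂) → V₃) (hF : IsCIndHom k U F)
    (β : V₁ → G → V₂) (hβ : IsIndHom k U β) (hβc : ∀ x, FinSupp U (β x)) :
    ∀ φ : G → V₁, IsCInd U φ →
      J'map U F (pairFn β φ)
        = J'map U (fun ψ : G → V₁ => F (pairFn (Jmap β) ψ)) φ := by
  intro φ _
  obtain ⟨hlin, _, heq⟩ := hβ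
  have h0 : β 0 = 0 := by
    have h := hlin 1 0 0
    simpa using h
  unfold J'map
  refine finsum_congr fun q => ?_
  generalize q.out = g
  suffices h : charFn U g⁻¹ (g • pairFn β φ g)
      = pairFn (Jmap β) (charFn U g⁻¹ (g • φ g)) by
    simp only [h]
  funext x
  simp only [charFn, pairFn, Jmap]
  by_cases hx : x⁻¹ * g⁻¹ ∈ U
  · rw [if_pos hx, if_pos hx, inv_smul_smul, heq _ hx, smul_smul]
    simp [mul_assoc]
  · rw [if_neg hx, if_neg hx]
    simp [h0]
end
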